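/- There exists a universal constant C > 0 such that for every positive integer n, every ε ∈ (0,1), every δ ∈ (0,1), and every real B with e ≤ B ≤ 1/δ, there exist positive integers m ≤ C·B·ε⁻²·(log(1/δ)/log B)² and s ≤ C·ε⁻¹·(log(1/δ)/log B) and a probability distribution 𝒜 over m × n real matrices, supported on matrices that are sign-consistent and have at most s nonzero entries per column, such that for every x ∈ ℝⁿ, the probability over A ~ 𝒜 that (1−ε)‖x‖₂ ≤ ‖Ax‖₂ ≤ (1+ε)‖x‖₂ is greater than 1−δ. -/

import Mathlib

open MeasureTheory ProbabilityTheory Finset Real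

/-- The Euclidean (ℓ₂) norm of a vector in ℝᵏ. -/
noncomputable def l2norm {k : ℕ} (x : Fin k → ℝ) : ℝ :=
  Real.sqrt (∑ i, x i ^ 2)

/-- An `m × n` matrix (given as a function) is sign-consistent if in each column the
nonzero entries are either all positive or all negative. -/
def SignConsistent {m n : ℕ} (A : Fin m → Fin n → ℝ) : Prop :=
  ∀ j, (∀ i, 0 ≤ A i j) ∨ (∀ i, A i j ≤ 0)

/-- A matrix has at most `s` nonzero entries per column. -/
def ColSparse {m n : ℕ} (s : ℕ) (A : Fin m → Fin n → ℝ) : Prop :=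
  ∀ j, (Finset.univ.filter (fun i => A i j ≠ 0)).card ≤ s

/-- The matrix-vector product `A x`. -/
noncomputable def matVec {m n : ℕ} (A : Fin m → Fin n → ℝ) (x : Fin n → ℝ) : Fin m → ℝ :=
  fun i => ∑ j, A i j * x j

lemma exp_quad (u : ℝ) : Real.exp u ≤ 1 + u + u^2 * Real.exp |u| := by
  have h := Complex.norm_exp_sub_sum_le_norm_mul_exp (u:ℂ) 2
  simp [Finset.sum_range_succ] at h
  have h2 : Complex.exp u - (1 + u) = ((Real.exp u - (1+u) : ℝ) : ℂ) := by push_cast; ring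
  rw [h2, Complex.norm_real, Real.norm_eq_abs] at h
  have := le_abs_self (Real.exp u - (1+u))
  linarith

def sg (b : Bool) : ℝ := if b then 1 else -1

lemma sg_sq (b : Bool) : sg b ^ 2 = 1 := by cases b <;> simp [sg]
lemma sg_abs (b : Bool) : |sg b| = 1 := by cases b <;> simp [sg]

lemma sum_exp_block {k : ℕ} (hk : 0 < k) (S : Fin k → ℝ) (c Q : ℝ) (hQ : ∀ r, |c * S r| ≤ Q) :
    ∑ r, Real.exp (c * S r) ≤ k * Real.exp (c * (∑ r, S r) / k + c^2 * Real.exp Q * (∑ r, S r^2) / k) := by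
  have hk' : (0:ℝ) < k := by exact_mod_cast hk
  have h1 : ∑ r, Real.exp (c * S r) ≤ ∑ r, (1 + c * S r + c^2 * Real.exp Q * S r^2) := by
    apply Finset.sum_le_sum
    intro r _
    have := exp_quad (c * S r)
    have h2 := Real.exp_le_exp.2 (hQ r)
    have h3 : (c * S r)^2 * Real.exp |c * S r| ≤ (c * S r)^2 * Real.exp Q := by gcongr
    nlinarith
  have h4 : ∑ r, (1 + c * S r + c^2 * Real.exp Q * S r^2) = k * ((c * (∑ r, S r) / k + c^2 * Real.exp Q * (∑ r, S r^2) / k) + 1) := by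
    rw [Finset.sum_add_distrib, Finset.sum_add_distrib, ← Finset.mul_sum, ← Finset.mul_sum]
    simp
    field_simp
    ring
  rw [h4] at h1
  refine h1.trans ?_
  gcongr
  exact Real.add_one_le_exp _

lemma row_sq {k : ℕ} (S : Fin k → ℝ) (i : Fin k) (y : ℝ) :
    ∑ r, (S r + if i = r then y else 0)^2 = ∑ r, S r^2 + y^2 + 2 * y * S i := by
  have : ∀ r, (S r + if i = r then y else 0)^2 = S r^2 + (if i = r then y^2 + 2 * y * S r else 0) := by
    intro r; split_ifs <;> ring
  simp_rw [this, Finset.sum_add_distrib]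
  simp; ring

lemma sum_h {k s : ℕ} (S : Fin s → Fin k → ℝ) (c : ℝ) :
    ∑ h : Fin s → Fin k, Real.exp (c * ∑ b, S b (h b)) = ∏ b, ∑ r, Real.exp (c * S b r) := by
  rw [Finset.prod_univ_sum]
  simp [Finset.mul_sum, Real.exp_sum]

lemma step {k s : ℕ} (hk : 0 < k) (S : Fin s → Fin k → ℝ) (T x θ γ Θ α β : ℝ)
    (hT : ∀ b, ∑ r, S b r = T) (hx : ∀ b r, |x| * |S b r| ≤ 1)
    (hθ : |θ| ≤ Θ) (hα : 4 * Θ^2 * Real.exp (2 * Θ) ≤ α * k) (hβ : Θ * s ≤ β * k) (hβ8 : 8 * β ≤ 1)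
    (hγ0 : 0 ≤ γ) (hγ : γ ≤ β) :
    ∑ a : Bool × (Fin s → Fin k), Real.exp (θ * (∑ b, ∑ r, (S b r + if a.2 b = r then sg a.1 * x else 0)^2)
        + γ * (T + sg a.1 * x)^2)
      ≤ 2 * (k:ℝ)^s * Real.exp (θ * (∑ b, ∑ r, S b r^2) + θ * s * x^2 + α * x^2 * (∑ b, ∑ r, S b r^2)
          + γ * (T^2 + x^2) + β * x^2 * T^2) := by
  have hk' : (0:ℝ) < k := by exact_mod_cast hk
  have hΘ : 0 ≤ Θ := (abs_nonneg _).trans hθ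
  set W := ∑ b, ∑ r, S b r^2 with hW
  have hW0 : 0 ≤ W := Finset.sum_nonneg fun b _ => Finset.sum_nonneg fun r _ => sq_nonneg _
  have key : ∀ σ : Bool, ∑ h : Fin s → Fin k, Real.exp (θ * (∑ b, ∑ r, (S b r + if h b = r then sg σ * x else 0)^2)
        + γ * (T + sg σ * x)^2) ≤ (k:ℝ)^s * Real.exp (θ * W + θ * s * x^2 + α * x^2 * W
          + γ * (T^2 + x^2)) * Real.exp (sg σ * (2 * x * T * (θ * s / k + γ))) := by
    intro σ
    have e1 : ∀ h : Fin s → Fin k, Real.exp (θ * (∑ b, ∑ r, (S b r + if h b = r then sg σ * x else 0)^2)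
        + γ * (T + sg σ * x)^2) = Real.exp (θ * W + θ * s * x^2 + γ * (T^2 + x^2) + sg σ * (2 * x * T * γ)) * 
          Real.exp ((2 * θ * sg σ * x) * ∑ b, S b (h b)) := by
      intro h
      rw [← Real.exp_add]
      congr 1
      simp_rw [row_sq, Finset.sum_add_distrib, ← Finset.mul_sum]
      simp [← hW]
      have := sg_sq σ
      linear_combination (γ * x^2 + θ * s * x^2) * this
    simp_rw [e1]
    rw [← Finset.mul_sum, sum_h]
    have hb : ∀ b, ∑ r, Real.exp ((2 * θ * sg σ * x) * S b r) ≤ 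
        k * Real.exp ((2 * θ * sg σ * x) * T / k + α * x^2 * ∑ r, S b r^2) := by
      intro b
      have hQ : ∀ r, |(2 * θ * sg σ * x) * S b r| ≤ 2 * Θ := by
        intro r
        rw [abs_mul, abs_mul, abs_mul, abs_mul, sg_abs]
        have := hx b r
        have h0 := abs_nonneg θ
        have h1 : 0 ≤ |x| * |S b r| := by positivity
        simp only [abs_two]
        nlinarith
      refine (sum_exp_block hk (S b) _ _ hQ).trans ?_
      rw [hT b]
      gcongr
      have hs : 0 ≤ ∑ r, S b r^2 := Finset.sum_nonneg fun r _ => sq_nonneg _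
      have e : (2 * θ * sg σ * x)^2 = 4 * θ^2 * x^2 := by linear_combination (4 * θ^2 * x^2) * sg_sq σ
      rw [e, div_le_iff₀ hk']
      have h1 : θ^2 ≤ Θ^2 := by rw [← sq_abs θ]; gcongr
      calc 4 * θ^2 * x^2 * Real.exp (2 * Θ) * ∑ r, S b r^2 ≤ 4 * Θ^2 * x^2 * Real.exp (2 * Θ) * ∑ r, S b r^2 := by gcongr
        _ = (4 * Θ^2 * Real.exp (2 * Θ)) * (x^2 * ∑ r, S b r^2) := by ring
        _ ≤ (α * k) * (x^2 * ∑ r, S b r^2) := by gcongr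
        _ = _ := by ring
    calc _ ≤ Real.exp (θ * W + θ * s * x^2 + γ * (T^2 + x^2) + sg σ * (2 * x * T * γ)) * ∏ b : Fin s, 
          (k * Real.exp ((2 * θ * sg σ * x) * T / k + α * x^2 * ∑ r, S b r^2)) := by
            refine mul_le_mul_of_nonneg_left (Finset.prod_le_prod ?_ fun b _ => hb b) (Real.exp_pos _).le
            intro b _
            exact Finset.sum_nonneg fun r _ => (Real.exp_pos _).le
      _ = _ := by
        rw [Finset.prod_mul_distrib, ← Real.exp_sum, Finset.sum_add_distrib, ← Finset.mul_sum, ← hW]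
        simp only [Finset.prod_const, Finset.sum_const, Finset.card_univ, Fintype.card_fin, nsmul_eq_mul]
        rw [mul_left_comm, ← Real.exp_add, mul_assoc ((k:ℝ)^s), ← Real.exp_add]
        congr 2
        field_simp
        ring
  rw [Fintype.sum_prod_type]
  calc _ ≤ ∑ σ : Bool, _ := Finset.sum_le_sum fun σ _ => key σ
    _ = (2 * (k:ℝ)^s * Real.exp (θ * W + θ * s * x^2 + α * x^2 * W
          + γ * (T^2 + x^2))) * Real.cosh (2 * x * T * (θ * s / k + γ)) := by
        rw [Real.cosh_eq]; simp [sg]; ring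
    _ ≤ (2 * (k:ℝ)^s * Real.exp (θ * W + θ * s * x^2 + α * x^2 * W
          + γ * (T^2 + x^2))) * Real.exp (β * x^2 * T^2) := by
        gcongr
        refine (Real.cosh_le_exp_half_sq _).trans ?_
        gcongr
        have h1 : |θ * s / k + γ| ≤ 2 * β := by
          have : |θ * s / k| ≤ β := by
            rw [abs_div, abs_mul, Nat.abs_cast, Nat.abs_cast, div_le_iff₀ hk']
            refine le_trans ?_ hβ
            gcongr
          refine (abs_add_le _ _).trans ?_
          rw [abs_of_nonneg hγ0]; linarith
        have h2 : (θ * s / k + γ)^2 ≤ (2 * β)^2 := by rw [← sq_abs]; gcongr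
        have h3 : (2 * β)^2 ≤ β / 2 := by nlinarith [hγ0.trans hγ]
        have h4 : 0 ≤ x^2 * T^2 := by positivity
        nlinarith [mul_le_mul_of_nonneg_left (h2.trans h3) h4]
    _ = _ := by rw [mul_assoc, ← Real.exp_add]

lemma main_ind {k s : ℕ} (hk : 0 < k) (θ Θ α β : ℝ) (hα0 : 0 ≤ α)
    (hθ : |θ| + α ≤ Θ) (hα : 4 * Θ^2 * Real.exp (2 * Θ) ≤ α * k) (hβ0 : 0 ≤ β) (hβ : Θ * s ≤ β * k) (hβ8 : 8 * β ≤ 1) :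
    ∀ (n : ℕ) (x : Fin n → ℝ) (S : Fin s → Fin k → ℝ) (T M : ℝ) (_ : ∀ b, ∑ r, S b r = T)
      (_ : ∀ i j, i ≤ j → |x j| ≤ |x i|) (_ : 0 ≤ M) (_ : ∀ j b r, |x j| * |S b r| ≤ M)
      (_ : M + ∑ j, x j^2 ≤ 1),
    ∑ ω : Fin n → Bool × (Fin s → Fin k), 
      Real.exp (θ * (∑ b, ∑ r, (S b r + ∑ j, if (ω j).2 b = r then sg (ω j).1 * x j else 0)^2))
      ≤ (2 * (k:ℝ)^s)^n * Real.exp ((θ + α * ∑ j, x j^2) * (∑ b, ∑ r, S b r^2) + β * (∑ j, x j^2) * T^2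
         + (s * θ + s * α + β) * ∑ j, x j^2) := by
  intro n
  induction n with
  | zero => 
    intro x S T M _ _ _ _ _
    simp
  | succ n ih =>
    intro x S T M hT hanti hM hx hτ
    rw [← Equiv.sum_comp (Fin.consEquiv (fun _ => Bool × (Fin s → Fin k))), Fintype.sum_prod_type]
    rw [Fin.sum_univ_succ] at hτ ⊢
    set τ := ∑ j : Fin n, x j.succ^2 with hτdef
    have hτ0 : 0 ≤ τ := Finset.sum_nonneg fun j _ => sq_nonneg _
    have hx0 := sq_nonneg (x 0)
    have hτ1 : τ ≤ 1 := by linarith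
    set W := ∑ b, ∑ r, S b r^2 with hW
    have hW0 : 0 ≤ W := Finset.sum_nonneg fun b _ => Finset.sum_nonneg fun r _ => sq_nonneg _
    have inner : ∀ a : Bool × (Fin s → Fin k), ∑ ω : Fin n → Bool × (Fin s → Fin k), 
      Real.exp (θ * (∑ b, ∑ r, (S b r + ∑ j, if ((Fin.consEquiv (fun _ => Bool × (Fin s → Fin k))) (a, ω) j).2 b = r 
        then sg ((Fin.consEquiv (fun _ => Bool × (Fin s → Fin k))) (a, ω) j).1 * x j else 0)^2))
      ≤ (2 * (k:ℝ)^s)^n * (Real.exp ((s * θ + s * α + β) * τ) * Real.exp ((θ + α * τ) * (∑ b, ∑ r, (S b r + if a.2 b = r then sg a.1 * x 0 else 0)^2)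
        + (β * τ) * (T + sg a.1 * x 0)^2)) := by
      intro a
      have := ih (fun j => x j.succ) (fun b r => S b r + if a.2 b = r then sg a.1 * x 0 else 0) (T + sg a.1 * x 0)
        (M + x 0^2) ?_ ?_ ?_ ?_ ?_
      · convert this using 1
        · apply Finset.sum_congr rfl
          intro ω _
          simp only [Fin.sum_univ_succ, Fin.consEquiv_apply, Fin.cons_zero, Fin.cons_succ, add_assoc]
        · rw [← Real.exp_add]
          congr 2
          ring
      · intro b
        rw [Finset.sum_add_distrib, hT b]
        simp
      · intro i j hij
        exact hanti _ _ (Fin.succ_le_succ_iff.2 hij)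
      · positivity
      · intro j b r
        have h1 := hanti 0 j.succ (Fin.zero_le _)
        have h2 := hx 0 b r
        have h3 : |S b r + if a.2 b = r then sg a.1 * x 0 else 0| ≤ |S b r| + |x 0| := by
          refine (abs_add_le _ _).trans ?_
          refine add_le_add le_rfl ?_
          split_ifs
          · rw [abs_mul, sg_abs, one_mul]
          · simp
        calc _ ≤ |x 0| * (|S b r| + |x 0|) := by gcongr
          _ ≤ _ := by rw [mul_add, ← sq, sq_abs]; linarith
      · linarith
    have hατ : α * τ ≤ α := by nlinarith
    have hβτ : β * τ ≤ β := by nlinarith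
    have hατ0 : 0 ≤ α * τ := by positivity
    have hstep := step hk S T (x 0) (θ + α * τ) (β * τ) Θ α β hT (fun b r => (hx 0 b r).trans (by linarith))
      ((abs_add_le _ _).trans (by rw [abs_of_nonneg hατ0]; linarith)) hα hβ hβ8 (by positivity) hβτ
    calc _ ≤ ∑ a, _ := Finset.sum_le_sum fun a _ => inner a
      _ = (2 * (k:ℝ)^s)^n * (Real.exp ((s * θ + s * α + β) * τ) * ∑ a : Bool × (Fin s → Fin k), Real.exp ((θ + α * τ) * (∑ b, ∑ r, (S b r + if a.2 b = r then sg a.1 * x 0 else 0)^2)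
        + (β * τ) * (T + sg a.1 * x 0)^2)) := by rw [← Finset.mul_sum, ← Finset.mul_sum]
      _ ≤ (2 * (k:ℝ)^s)^n * (Real.exp ((s * θ + s * α + β) * τ) * _) :=
        mul_le_mul_of_nonneg_left (mul_le_mul_of_nonneg_left hstep (Real.exp_pos _).le) (by positivity)
      _ = (2 * (k:ℝ)^s)^(n+1) * Real.exp ((s * θ + s * α + β) * τ + ((θ + α * τ) * W + (θ + α * τ) * s * x 0^2 + α * x 0^2 * W
          + β * τ * (T^2 + x 0^2) + β * x 0^2 * T^2)) := by
          rw [← hW, Real.exp_add ((s * θ + s * α + β) * τ), pow_succ]; ring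
      _ ≤ _ := by
        refine mul_le_mul_of_nonneg_left (Real.exp_le_exp.2 ?_) (by positivity)
        have : (s:ℝ) * x 0^2 * (α * τ) ≤ s * x 0^2 * α := by gcongr
        nlinarith

/-- The random quantity. -/
noncomputable def Wf {k s n : ℕ} (ω : Fin n → Bool × (Fin s → Fin k)) (x : Fin n → ℝ) : ℝ :=
  ∑ b, ∑ r, (∑ j, if (ω j).2 b = r then sg (ω j).1 * x j else 0)^2

lemma mgf {k s : ℕ} (hk : 0 < k) (θ Θ α β : ℝ) (hα0 : 0 ≤ α)
    (hθ : |θ| + α ≤ Θ) (hα : 4 * Θ^2 * Real.exp (2 * Θ) ≤ α * k) (hβ0 : 0 ≤ β) (hβ : Θ * s ≤ β * k) (hβ8 : 8 * β ≤ 1)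
    (n : ℕ) (x : Fin n → ℝ) (hx : ∑ j, x j^2 = 1) :
    ∑ ω : Fin n → Bool × (Fin s → Fin k), Real.exp (θ * Wf ω x) ≤
      (2 * (k:ℝ)^s)^n * Real.exp (s * θ + s * α + β) := by
  set p := Tuple.sort (fun j => - |x j|) with hp
  have hmono := Tuple.monotone_sort (fun j => - |x j|)
  have hs : ∑ j, x (p j)^2 = 1 := by rw [← hx]; exact Equiv.sum_comp p (fun j => x j^2)
  have := main_ind hk θ Θ α β hα0 hθ hα hβ0 hβ hβ8 n (fun j => x (p j)) (fun _ _ => 0) 0 0 (by simp)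
    (by intro i j hij; have := hmono hij; simpa using this) le_rfl (by simp) (by rw [hs]; simp)
  rw [hs] at this
  simp only [zero_add, ne_eq, OfNat.ofNat_ne_zero, not_false_eq_true, zero_pow, Finset.sum_const_zero, mul_zero, mul_one] at this
  refine le_trans (le_of_eq ?_) this
  rw [← Equiv.sum_comp (Equiv.arrowCongr p (Equiv.refl (Bool × (Fin s → Fin k))))]
  apply Finset.sum_congr rfl
  intro ω _
  congr 2
  unfold Wf
  apply Finset.sum_congr rfl
  intro b _
  apply Finset.sum_congr rfl
  intro r _
  congr 1
  rw [← Equiv.sum_comp p]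
  simp [Equiv.arrowCongr]

lemma tail {k s : ℕ} (hk : 0 < k) (θ Θ α β ε : ℝ) (hα0 : 0 ≤ α) (hθ0 : 0 ≤ θ)
    (hθ : θ + α ≤ Θ) (hα : 4 * Θ^2 * Real.exp (2 * Θ) ≤ α * k) (hβ0 : 0 ≤ β) (hβ : Θ * s ≤ β * k) (hβ8 : 8 * β ≤ 1)
    (n : ℕ) (x : Fin n → ℝ) (hx : ∑ j, x j^2 = 1) (P : (Fin n → Bool × (Fin s → Fin k)) → Prop) [DecidablePred P]
    (hP : ∀ ω, P ω → s * (1 + ε) ≤ Wf ω x ∨ Wf ω x ≤ s * (1 - ε)) :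
    ((Finset.univ.filter P).card : ℝ) ≤ (2 * (k:ℝ)^s)^n * (2 * Real.exp (- θ * s * ε + s * α + β)) := by
  have h1 := mgf hk θ Θ α β hα0 (by rwa [abs_of_nonneg hθ0]) hα hβ0 hβ hβ8 n x hx
  have h2 := mgf hk (-θ) Θ α β hα0 (by rwa [abs_neg, abs_of_nonneg hθ0]) hα hβ0 hβ hβ8 n x hx
  have h3 : ((Finset.univ.filter P).card : ℝ) ≤ ∑ ω : Fin n → Bool × (Fin s → Fin k), 
      (Real.exp (- θ * s * (1 + ε)) * Real.exp (θ * Wf ω x) + Real.exp (θ * s * (1 - ε)) * Real.exp (-θ * Wf ω x)) := by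
    rw [Finset.card_filter]
    push_cast
    apply Finset.sum_le_sum
    intro ω _
    rw [← Real.exp_add, ← Real.exp_add]
    split_ifs with h
    · rcases hP ω h with h | h
      · have : 1 ≤ Real.exp (- θ * s * (1 + ε) + θ * Wf ω x) := by
          rw [Real.one_le_exp_iff]; nlinarith
        linarith [Real.exp_pos (θ * s * (1 - ε) + -θ * Wf ω x)]
      · have : 1 ≤ Real.exp (θ * s * (1 - ε) + -θ * Wf ω x) := by
          rw [Real.one_le_exp_iff]; nlinarith
        linarith [Real.exp_pos (- θ * s * (1 + ε) + θ * Wf ω x)]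
    · positivity
  refine h3.trans ?_
  rw [Finset.sum_add_distrib, ← Finset.mul_sum, ← Finset.mul_sum]
  calc _ ≤ Real.exp (- θ * s * (1 + ε)) * ((2 * (k:ℝ)^s)^n * Real.exp (s * θ + s * α + β)) 
        + Real.exp (θ * s * (1 - ε)) * ((2 * (k:ℝ)^s)^n * Real.exp (s * -θ + s * α + β)) := by gcongr
    _ = (2 * (k:ℝ)^s)^n * (Real.exp (- θ * s * (1 + ε)) * Real.exp (s * θ + s * α + β) + Real.exp (θ * s * (1 - ε)) * Real.exp (s * -θ + s * α + β)) := by ring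
    _ = _ := by
      rw [← Real.exp_add, ← Real.exp_add, two_mul (Real.exp _)]
      congr 3 <;> ring

lemma exists_unif {Ω X : Type} [Fintype Ω] [Nonempty Ω] [MeasurableSpace X] [MeasurableSingletonClass X] (f : Ω → X) :
    ∃ μ : Measure X, ∀ (S : Set X) [DecidablePred (fun ω => f ω ∈ S)],
      μ S = ENNReal.ofReal (((Finset.univ.filter (fun ω => f ω ∈ S)).card : ℝ) / Fintype.card Ω) := by
  refine ⟨∑ ω : Ω, (ENNReal.ofReal ((Fintype.card Ω : ℝ)⁻¹)) • Measure.dirac (f ω), ?_⟩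
  intro S _
  rw [Measure.finsetSum_apply]
  simp only [Measure.smul_apply, Measure.dirac_apply, smul_eq_mul]
  rw [← Finset.mul_sum, div_eq_inv_mul, ENNReal.ofReal_mul (by positivity), ENNReal.ofReal_natCast]
  congr 1
  rw [Finset.card_filter]
  push_cast
  apply Finset.sum_congr rfl
  intro ω _
  simp [Set.indicator_apply]

/-- The random matrix. -/
noncomputable def Amat {k s n : ℕ} (ω : Fin n → Bool × (Fin s → Fin k)) : Fin (s * k) → Fin n → ℝ :=
  fun i j => if (ω j).2 (finProdFinEquiv.symm i).1 = (finProdFinEquiv.symm i).2 then sg (ω j).1 / Real.sqrt s else 0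

lemma Amat_sc {k s n : ℕ} (ω : Fin n → Bool × (Fin s → Fin k)) : SignConsistent (Amat ω) := by
  intro j
  cases h : (ω j).1
  · right
    intro i
    unfold Amat
    split_ifs
    · rw [h]; simp only [sg]; rw [if_neg (by simp), neg_div]; exact neg_nonpos.2 (by positivity)
    · exact le_rfl
  · left
    intro i
    unfold Amat
    split_ifs
    · rw [h]; simp [sg]
    · exact le_rfl

lemma Amat_sparse {k s n : ℕ} (ω : Fin n → Bool × (Fin s → Fin k)) : ColSparse s (Amat ω) := by
  intro j
  calc _ ≤ (Finset.univ.image (fun b : Fin s => finProdFinEquiv (b, (ω j).2 b))).card := by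
        apply Finset.card_le_card
        intro i hi
        have hi := (Finset.mem_filter.1 hi).2
        simp only [Finset.mem_image, Finset.mem_univ, true_and]
        refine ⟨(finProdFinEquiv.symm i).1, ?_⟩
        have : (ω j).2 (finProdFinEquiv.symm i).1 = (finProdFinEquiv.symm i).2 := by
          by_contra h
          exact hi (if_neg h)
        rw [this]
        exact finProdFinEquiv.apply_symm_apply i
    _ ≤ _ := Finset.card_image_le.trans (by simp)

lemma l2_Amat {k s n : ℕ} (ω : Fin n → Bool × (Fin s → Fin k)) (x : Fin n → ℝ) :
    l2norm (matVec (Amat ω) x) = Real.sqrt (Wf ω x / s) := by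
  unfold l2norm
  congr 1
  rw [← Equiv.sum_comp finProdFinEquiv, Fintype.sum_prod_type]
  unfold Wf
  rw [Finset.sum_div]
  apply Finset.sum_congr rfl
  intro b _
  rw [Finset.sum_div]
  apply Finset.sum_congr rfl
  intro r _
  have : matVec (Amat ω) x (finProdFinEquiv (b, r)) = (∑ j, if (ω j).2 b = r then sg (ω j).1 * x j else 0) / Real.sqrt s := by
    unfold matVec Amat
    rw [Finset.sum_div]
    apply Finset.sum_congr rfl
    intro j _
    simp only [Equiv.symm_apply_apply]
    split_ifs <;> ring
  rw [this, div_pow, Real.sq_sqrt (by positivity)]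

lemma Wf_smul {k s n : ℕ} (ω : Fin n → Bool × (Fin s → Fin k)) (x : Fin n → ℝ) (c : ℝ) :
    Wf ω (fun j => c * x j) = c^2 * Wf ω x := by
  unfold Wf
  simp_rw [Finset.mul_sum, ← mul_pow, Finset.mul_sum]
  refine Finset.sum_congr rfl fun b _ => Finset.sum_congr rfl fun r _ => ?_
  congr 1
  refine Finset.sum_congr rfl fun j _ => ?_
  split_ifs <;> ring

lemma bad_case {k s n : ℕ} (hs : 0 < s) (ω : Fin n → Bool × (Fin s → Fin k)) (x : Fin n → ℝ) (ε : ℝ) (h0 : 0 < ε) (h1 : ε < 1)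
    (hN : 0 < l2norm x)
    (h : ¬ ((1 - ε) * l2norm x ≤ l2norm (matVec (Amat ω) x) ∧ l2norm (matVec (Amat ω) x) ≤ (1 + ε) * l2norm x)) :
    s * (1 + ε) ≤ Wf ω (fun j => (l2norm x)⁻¹ * x j) ∨ Wf ω (fun j => (l2norm x)⁻¹ * x j) ≤ s * (1 - ε) := by
  have hs' : (0:ℝ) < s := by exact_mod_cast hs
  rw [Wf_smul]
  rw [l2_Amat] at h
  set N := l2norm x
  have hW : 0 ≤ Wf ω x := Finset.sum_nonneg fun b _ => Finset.sum_nonneg fun r _ => sq_nonneg _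
  rw [not_and_or, not_le, not_le] at h
  rcases h with h | h
  · right
    rw [Real.sqrt_lt' (by apply mul_pos _ hN; linarith), div_lt_iff₀ hs'] at h
    rw [inv_pow, inv_mul_le_iff₀ (by positivity)]
    have : (1-ε)^2 ≤ 1 - ε := by nlinarith
    calc _ ≤ ((1 - ε) * N)^2 * s := h.le
      _ = (1-ε)^2 * (N^2 * s) := by ring
      _ ≤ (1-ε) * (N^2 * s) := by gcongr
      _ = _ := by ring
  · left
    rw [Real.lt_sqrt (by positivity), lt_div_iff₀ hs'] at h
    rw [inv_pow, le_inv_mul_iff₀ (by positivity)]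
    have : 1 + ε ≤ (1+ε)^2 := by nlinarith
    calc _ = (1+ε) * (N^2 * s) := by ring
      _ ≤ (1+ε)^2 * (N^2 * s) := by gcongr
      _ = ((1 + ε) * N)^2 * s := by ring
      _ ≤ _ := h.le

lemma params (ε δ B : ℝ) (hε : ε ∈ Set.Ioo (0 : ℝ) 1) (hδ : δ ∈ Set.Ioo (0 : ℝ) 1)
    (hB : Real.exp 1 ≤ B) (hBδ : B ≤ 1 / δ) :
    ∃ s k : ℕ, 0 < s ∧ 0 < k ∧ ((s * k : ℕ) : ℝ) ≤ 17290 * B * ε⁻¹ ^ 2 * (Real.log (1 / δ) / Real.log B) ^ 2 ∧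
      (s : ℝ) ≤ 17290 * ε⁻¹ * (Real.log (1 / δ) / Real.log B) ∧
      ∃ θ Θ α : ℝ, 0 ≤ α ∧ 0 ≤ θ ∧ θ + α ≤ Θ ∧ 4 * Θ^2 * Real.exp (2 * Θ) ≤ α * k ∧ Θ * s ≤ (1/8) * k ∧
        2 * Real.exp (- θ * s * ε + s * α + 1/8) < δ := by
  obtain ⟨hε0, hε1⟩ := hε
  obtain ⟨hδ0, hδ1⟩ := hδ
  have hB0 : 0 < B := (Real.exp_pos 1).trans_le hB
  set ℓ := Real.log B with hℓ
  have hℓ1 : 1 ≤ ℓ := (Real.le_log_iff_exp_le hB0).2 hB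
  have hℓ0 : 0 < ℓ := by linarith
  set D := Real.log (1 / δ) with hD
  have hDℓ : ℓ ≤ D := Real.log_le_log hB0 hBδ
  set p := D / ℓ with hp
  have hp1 : 1 ≤ p := (one_le_div hℓ0).2 hDℓ
  have hpℓ : p * ℓ = D := by rw [hp]; field_simp
  have hei : 1 ≤ ε⁻¹ := (one_le_inv₀ hε0).2 hε1.le
  set R := Real.sqrt B with hR
  have hR2 : R^2 = B := Real.sq_sqrt hB0.le
  have hR0 : 0 < R := Real.sqrt_pos.2 hB0
  have hB1 : 1 ≤ B := by linarith [Real.add_one_le_exp (1:ℝ)]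
  have hexp : Real.exp (2 * (ℓ/4)) = R := by
    rw [hR, Real.sqrt_eq_rpow, Real.rpow_def_of_pos hB0, ← hℓ]; congr 1; ring
  have hℓR : ℓ ≤ 2 * R := by
    have := Real.add_one_le_exp (2 * (ℓ/4)); rw [hexp] at this; linarith
  have hR1 : 1 ≤ R := by nlinarith
  have hpe : 1 ≤ p * ε⁻¹ := by nlinarith
  set q := p * ε⁻¹ with hq
  have hqε : q * ε = p := by rw [hq]; field_simp
  have hs1 : 64 * q ≤ ⌈64 * q⌉₊ := Nat.le_ceil _
  have hs2 : (⌈64 * q⌉₊ : ℝ) ≤ 65 * q := by linarith [(Nat.ceil_lt_add_one (a := 64 * q) (by linarith)).le]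
  have hBq : 1 ≤ B * q := by nlinarith
  have hk1 : 265 * (B * q) ≤ ⌈265 * (B * q)⌉₊ := Nat.le_ceil _
  have hk2 : (⌈265 * (B * q)⌉₊ : ℝ) ≤ 266 * (B * q) := by linarith [(Nat.ceil_lt_add_one (a := 265 * (B * q)) (by linarith)).le]
  set s := ⌈64 * q⌉₊
  set k := ⌈265 * (B * q)⌉₊
  have hs0 : (0:ℝ) < s := by linarith
  have hk0 : (0:ℝ) < k := by linarith
  have hℓRB : ℓ * R ≤ 2 * B := by nlinarith
  refine ⟨s, k, by exact_mod_cast hs0, by exact_mod_cast hk0, ?_, ?_, ℓ/8, ℓ/4, ℓ^2 * R / (4 * k), by positivity, by positivity, ?_, ?_, ?_, ?_⟩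
  · push_cast
    calc (s:ℝ) * k ≤ (65 * q) * (266 * (B * q)) := by gcongr
      _ = 65 * 266 * B * ε⁻¹^2 * p^2 := by rw [hq]; ring
      _ ≤ _ := by gcongr; norm_num
  · calc (s:ℝ) ≤ 65 * q := hs2
      _ ≤ 17290 * q := by linarith
      _ = _ := by rw [hq]; ring
  · have : ℓ^2 * R / (4 * k) ≤ ℓ / 8 := by
      rw [div_le_iff₀ (by positivity)]
      have hk3 : 4 * B ≤ k := by nlinarith
      calc ℓ^2 * R = ℓ * (ℓ * R) := by ring
        _ ≤ ℓ * (k / 2) := by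
          apply mul_le_mul_of_nonneg_left _ hℓ0.le
          linarith
        _ = _ := by ring
    linarith
  · rw [hexp]
    apply le_of_eq
    field_simp
    try ring
  · have : ℓ ≤ 2 * B := by nlinarith
    calc ℓ / 4 * s ≤ (2 * B) / 4 * (65 * q) := by gcongr
      _ ≤ _ := by nlinarith
  · have h1 : ℓ^2 * R / (4 * k) ≤ ℓ * ε / 16 := by
      rw [div_le_iff₀ (by positivity)]
      have h2 : 265 * B ≤ k * ε := by
        calc 265 * B ≤ 265 * B * p := by nlinarith
          _ = 265 * (B * q) * ε := by rw [← hqε]; ring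
          _ ≤ _ := by gcongr
      calc ℓ^2 * R = ℓ * (ℓ * R) := by ring
        _ ≤ ℓ * (k * ε / 4) := by
          apply mul_le_mul_of_nonneg_left _ hℓ0.le
          linarith
        _ = _ := by ring
    have h3 : (s:ℝ) * (ℓ^2 * R / (4 * k)) ≤ s * (ℓ * ε / 16) := by gcongr
    have h4 : 64 * D ≤ s * ε * ℓ := by
      calc 64 * D = 64 * q * ε * ℓ := by rw [← hpℓ, ← hqε]; ring
        _ ≤ _ := by gcongr
    have h5 : - (ℓ/8) * s * ε + s * (ℓ^2 * R / (4 * k)) + 1/8 ≤ - D - 1 := by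
      have h6 : - (ℓ/8) * s * ε + s * (ℓ * ε / 16) = - (s * ε * ℓ) / 16 := by ring
      linarith
    have hδe : δ = Real.exp (-D) := by
      rw [hD, one_div, Real.log_inv, neg_neg, Real.exp_log hδ0]
    calc _ ≤ 2 * Real.exp (-D - 1) := by gcongr
      _ = δ * (2 * Real.exp (-1)) := by rw [hδe, sub_eq_add_neg, Real.exp_add]; ring
      _ < δ * 1 := by
        gcongr
        rw [Real.exp_neg]
        have := Real.exp_one_gt_d9
        rw [← div_eq_mul_inv, div_lt_one (Real.exp_pos 1)]
        linarith
      _ = δ := mul_one _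

theorem sparse_sign_consistent_JL_tradeoff :
    ∃ C : ℝ, 0 < C ∧
      ∀ (n : ℕ), 0 < n →
      ∀ (ε δ B : ℝ), ε ∈ Set.Ioo (0 : ℝ) 1 → δ ∈ Set.Ioo (0 : ℝ) 1 →
        Real.exp 1 ≤ B → B ≤ 1 / δ →
        ∃ (m s : ℕ), 0 < m ∧ 0 < s ∧
          (m : ℝ) ≤ C * B * ε⁻¹ ^ 2 * (Real.log (1 / δ) / Real.log B) ^ 2 ∧
          (s : ℝ) ≤ C * ε⁻¹ * (Real.log (1 / δ) / Real.log B) ∧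
          ∃ μ : Measure (Fin m → Fin n → ℝ), IsProbabilityMeasure μ ∧
            μ {A | SignConsistent A ∧ ColSparse s A} = 1 ∧
            ∀ x : Fin n → ℝ,
              ENNReal.ofReal (1 - δ) <
                μ {A | (1 - ε) * l2norm x ≤ l2norm (matVec A x) ∧
                       l2norm (matVec A x) ≤ (1 + ε) * l2norm x} := by
  classical
  refine ⟨17290, by norm_num, ?_⟩
  intro n hn ε δ B hε hδ hB hBδ
  obtain ⟨s, k, hs, hk, hm, hsb, θ, Θ, α, hα0, hθ0, hθ, hα, hβ, hfin⟩ := params ε δ B hε hδ hB hBδ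
  refine ⟨s * k, s, Nat.mul_pos hs hk, hs, hm, hsb, ?_⟩
  haveI : Nonempty (Fin k) := ⟨⟨0, hk⟩⟩
  obtain ⟨μ, hμ⟩ := exists_unif (fun ω : Fin n → Bool × (Fin s → Fin k) => Amat ω)
  have hcard : (Fintype.card (Fin n → Bool × (Fin s → Fin k)) : ℝ) = (2 * (k:ℝ)^s)^n := by simp
  have hcard0 : (0:ℝ) < (2 * (k:ℝ)^s)^n := by have : (0:ℝ) < k := by exact_mod_cast hk
                                              positivity
  have hone : ∀ S : Set (Fin (s * k) → Fin n → ℝ), (∀ ω, Amat ω ∈ S) → μ S = 1 := by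
    intro S hS
    rw [hμ, Finset.filter_true_of_mem (fun ω _ => hS ω), Finset.card_univ, hcard, div_self hcard0.ne']
    simp
  refine ⟨μ, ⟨hone _ fun _ => Set.mem_univ _⟩, hone _ fun ω => ⟨Amat_sc ω, Amat_sparse ω⟩, ?_⟩
  intro x
  have hN0 : 0 ≤ l2norm x := Real.sqrt_nonneg _
  rcases hN0.eq_or_lt with hN | hN
  · have hx : ∀ j, x j = 0 := by
      have h0 : ∑ i, x i^2 = 0 := by
        have := hN.symm
        unfold l2norm at this
        rwa [Real.sqrt_eq_zero (Finset.sum_nonneg fun i _ => sq_nonneg _)] at this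
      intro j
      have := (Finset.sum_eq_zero_iff_of_nonneg (fun i _ => sq_nonneg (x i))).1 h0 j (Finset.mem_univ _)
      exact pow_eq_zero_iff (two_ne_zero) |>.1 this
    rw [hone]
    · rw [ENNReal.ofReal_lt_one]; linarith [hδ.1]
    · intro ω
      simp only [Set.mem_setOf_eq, ← hN]
      have : l2norm (matVec (Amat ω) x) = 0 := by simp [l2norm, matVec, hx]
      rw [this]; simp
  · rw [hμ]
    have hx1 : ∑ j, ((l2norm x)⁻¹ * x j)^2 = 1 := by
      simp_rw [mul_pow, ← Finset.mul_sum]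
      have : ∑ i, x i^2 = (l2norm x)^2 := by
        unfold l2norm; rw [Real.sq_sqrt (Finset.sum_nonneg fun i _ => sq_nonneg _)]
      rw [this]; field_simp
    have ht := tail hk θ Θ α (1/8) ε hα0 hθ0 hθ hα (by norm_num) hβ (by norm_num) n _ hx1
      (fun ω => ¬ (Amat ω ∈ {A : Fin (s * k) → Fin n → ℝ | (1 - ε) * l2norm x ≤ l2norm (matVec A x) ∧
                       l2norm (matVec A x) ≤ (1 + ε) * l2norm x}))
      (fun ω h => bad_case hs ω x ε hε.1 hε.2 hN h)
    have hsum := Finset.card_filter_add_card_filter_not (s := (Finset.univ : Finset (Fin n → Bool × (Fin s → Fin k)))) (fun ω => Amat ω ∈ {A : Fin (s * k) → Fin n → ℝ | (1 - ε) * l2norm x ≤ l2norm (matVec A x) ∧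
                       l2norm (matVec A x) ≤ (1 + ε) * l2norm x})
    rw [Finset.card_univ] at hsum
    have hsum' := congrArg (Nat.cast (R := ℝ)) hsum
    rw [hcard] at hsum'
    push_cast at hsum'
    have hlt : 1 - δ < ((Finset.univ.filter (fun ω : Fin n → Bool × (Fin s → Fin k) => Amat ω ∈ {A : Fin (s * k) → Fin n → ℝ | (1 - ε) * l2norm x ≤ l2norm (matVec A x) ∧
                       l2norm (matVec A x) ≤ (1 + ε) * l2norm x})).card : ℝ) / Fintype.card (Fin n → Bool × (Fin s → Fin k)) := by
      rw [hcard, lt_div_iff₀ hcard0]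
      have := mul_lt_mul_of_pos_left hfin hcard0
      linarith
    exact (ENNReal.ofReal_lt_ofReal_iff (by linarith [hδ.2])).2 hlt
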